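/- Consider a pure jump Markov process on ℝ^d with data (λ,k,P₀) and time marginals P_t = Σ_{n≥0} P_{n,t}, where λ̄:=sup_x λ(x)<∞. Then for every t>0, every s≥0 and every n∈ℕ, one has the domination of measures P_{n,s}(dx) ≤ e^{λ̄(t−s)⁺} (s/t)ⁿ P_{n,t}(dx), where (t−s)⁺=max(t−s,0). -/

import Mathlib

open MeasureTheory ProbabilityTheory

/-- The measure `P_{n,t}` (contribution to the time-`t` marginal of the pure jump Markov
process from trajectories with exactly `n` jumps on `[0,t]`), defined recursively over the
last jump time. -/
noncomputable def jumpMarginalN {E : Type*} [MeasurableSpace E]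
    (l : E → ℝ) (k : Kernel E E) (P0 : Measure E) : ℕ → ℝ → Measure E
  | 0, t => P0.withDensity fun x => ENNReal.ofReal (Real.exp (-(l x) * t))
  | n + 1, t =>
      (volume.restrict (Set.Icc (0:ℝ) t)).bind fun s =>
        ((jumpMarginalN l k P0 n s).withDensity fun x => ENNReal.ofReal (l x)).bind
          fun x => (k x).withDensity fun y => ENNReal.ofReal (Real.exp (-(l y) * (t - s)))

namespace ProbabilityTheory.Kernel

variable {α β γ : Type*} [MeasurableSpace α] [MeasurableSpace β] [MeasurableSpace γ]

lemma snd_compProd_eq_bind (κ : Kernel α β) [IsSFiniteKernel κ] (η : Kernel (α × β) γ)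
    [IsSFiniteKernel η] (a : α) :
    (κ ⊗ₖ η).snd a = (κ a).bind fun b => η (a, b) := by
  have hm : Measurable fun b => η (a, b) := η.measurable.comp measurable_prodMk_left
  ext A hA
  rw [snd_apply' _ _ hA, compProd_apply (measurable_snd hA), Measure.bind_apply hA hm.aemeasurable]
  rfl

instance isSFiniteKernel_withDensity_ofReal (κ : Kernel α β) [IsSFiniteKernel κ]
    (f : α → β → ℝ) : IsSFiniteKernel (κ.withDensity fun a b => ENNReal.ofReal (f a b)) :=
  IsSFiniteKernel.withDensity κ fun _ _ => ENNReal.ofReal_ne_top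

end ProbabilityTheory.Kernel

lemma MeasureTheory.withDensity_mono_measure {α : Type*} [MeasurableSpace α] {μ ν : Measure α}
    (h : μ ≤ ν) (f : α → ENNReal) : μ.withDensity f ≤ ν.withDensity f := by
  refine Measure.le_iff.2 fun s hs => ?_
  rw [withDensity_apply _ hs, withDensity_apply _ hs]
  exact lintegral_mono' (Measure.restrict_mono le_rfl h) le_rfl

lemma withDensity_exp_le_smul {E : Type*} [MeasurableSpace E] (μ : Measure E) {l : E → ℝ}
    (hl : Measurable l) (hl0 : ∀ x, 0 ≤ l x) {lbar : ℝ} (hlbar : ∀ x, l x ≤ lbar) (r q : ℝ) :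
    μ.withDensity (fun y => ENNReal.ofReal (Real.exp (-(l y) * r)))
      ≤ ENNReal.ofReal (Real.exp (lbar * max (q - r) 0)) •
        μ.withDensity fun y => ENNReal.ofReal (Real.exp (-(l y) * q)) := by
  rw [← withDensity_smul _ (by fun_prop)]
  refine withDensity_mono (.of_forall fun y => ?_)
  simp only [Pi.smul_apply, smul_eq_mul]
  rw [← ENNReal.ofReal_mul (Real.exp_nonneg _), ← Real.exp_add]
  gcongr
  have h₁ : l y * (q - r) ≤ l y * max (q - r) 0 :=
    mul_le_mul_of_nonneg_left (le_max_left _ _) (hl0 y)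
  have h₂ : l y * max (q - r) 0 ≤ lbar * max (q - r) 0 :=
    mul_le_mul_of_nonneg_right (hlbar y) (le_max_right _ _)
  linarith

lemma setLIntegral_Icc_mul_left {c : ℝ} (hc : 0 < c) (t : ℝ) {g : ℝ → ENNReal}
    (hg : Measurable g) :
    ∫⁻ u in Set.Icc 0 (c * t), g u = ENNReal.ofReal c * ∫⁻ v in Set.Icc 0 t, g (c * v) := by
  rw [← lintegral_indicator measurableSet_Icc, ← lintegral_indicator measurableSet_Icc]
  conv_lhs => rw [← Real.smul_map_volume_mul_left hc.ne']
  rw [lintegral_smul_measure, lintegral_map (hg.indicator measurableSet_Icc) (by fun_prop),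
    abs_of_pos hc, smul_eq_mul]
  congr 2 with v
  simp only [Set.indicator, Set.mem_Icc, mul_nonneg_iff_of_pos_left hc, mul_le_mul_iff_right₀ hc]

section JumpKernel

variable {E : Type*} [MeasurableSpace E]

/-- The law at time `p.1` restricted to trajectories whose last jump occurs at time `p.2`,
as a density in `p.2`, where `κ p.2` is the law of the position just before that jump. -/
noncomputable def lastJump (l : E → ℝ) (k : Kernel E E) (κ : ℝ → Measure E) (p : ℝ × ℝ) :
    Measure E :=
  ((κ p.2).withDensity fun x => ENNReal.ofReal (l x)).bind
    fun x => (k x).withDensity fun y => ENNReal.ofReal (Real.exp (-(l y) * (p.1 - p.2)))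

lemma measurable_withDensity_exp {l : E → ℝ} (hl : Measurable l) (k : Kernel E E)
    [IsSFiniteKernel k] (r : ℝ) :
    Measurable fun x => (k x).withDensity fun y => ENNReal.ofReal (Real.exp (-(l y) * r)) := by
  have hf : Measurable (Function.uncurry
      fun (_ : E) (y : E) => ENNReal.ofReal (Real.exp (-(l y) * r))) := by
    unfold Function.uncurry; fun_prop
  convert (k.withDensity fun _ y => ENNReal.ofReal (Real.exp (-(l y) * r))).measurable with x
  rw [Kernel.withDensity_apply _ hf]

lemma exists_kernel_lastJump {l : E → ℝ} (hl : Measurable l) (k : Kernel E E)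
    [IsSFiniteKernel k] (κ : Kernel ℝ E) [IsSFiniteKernel κ] :
    ∃ η : Kernel (ℝ × ℝ) E, IsSFiniteKernel η ∧ ∀ p, η p = lastJump l k κ p := by
  have hf : Measurable (Function.uncurry
      fun (_ : ℝ × ℝ) (x : E) => ENNReal.ofReal (l x)) := by
    unfold Function.uncurry; fun_prop
  have hg : Measurable (Function.uncurry fun (q : (ℝ × ℝ) × E) (y : E) =>
      ENNReal.ofReal (Real.exp (-(l y) * (q.1.1 - q.1.2)))) := by
    unfold Function.uncurry; fun_prop
  refine ⟨(((κ.comap Prod.snd measurable_snd).withDensity fun _ x => ENNReal.ofReal (l x)) ⊗ₖ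
    ((k.comap Prod.snd measurable_snd).withDensity fun q y =>
      ENNReal.ofReal (Real.exp (-(l y) * (q.1.1 - q.1.2))))).snd, inferInstance, fun p => ?_⟩
  rw [Kernel.snd_compProd_eq_bind, Kernel.withDensity_apply _ hf, lastJump, Kernel.comap_apply]
  congr 1 with x
  rw [Kernel.withDensity_apply _ hg, Kernel.comap_apply]

lemma jumpMarginalN_succ (l : E → ℝ) (k : Kernel E E) (P0 : Measure E) (n : ℕ) (t : ℝ) :
    jumpMarginalN l k P0 (n + 1) t = (volume.restrict (Set.Icc (0 : ℝ) t)).bind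
      fun s => lastJump l k (jumpMarginalN l k P0 n) (t, s) := rfl

lemma exists_kernel_jumpMarginalN {l : E → ℝ} (hl : Measurable l) (k : Kernel E E)
    [IsSFiniteKernel k] (P0 : Measure E) [SFinite P0] (n : ℕ) :
    ∃ κ : Kernel ℝ E, IsSFiniteKernel κ ∧ ⇑κ = jumpMarginalN l k P0 n := by
  induction n with
  | zero =>
    have hf : Measurable (Function.uncurry
        fun (t : ℝ) (x : E) => ENNReal.ofReal (Real.exp (-(l x) * t))) := by
      unfold Function.uncurry; fun_prop
    refine ⟨(Kernel.const ℝ P0).withDensity fun t x => ENNReal.ofReal (Real.exp (-(l x) * t)),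
      inferInstance, funext fun t => ?_⟩
    rw [Kernel.withDensity_apply _ hf, Kernel.const_apply, jumpMarginalN]
  | succ n ih =>
    obtain ⟨κ, _, hκ⟩ := ih
    obtain ⟨η, _, hη⟩ := exists_kernel_lastJump hl k κ
    have hf : Measurable (Function.uncurry
        fun (t s : ℝ) => (Set.Icc 0 t).indicator (1 : ℝ → ENNReal) s) := by
      have hS : MeasurableSet {p : ℝ × ℝ | 0 ≤ p.2 ∧ p.2 ≤ p.1} :=
        (measurableSet_le measurable_const measurable_snd).inter
          (measurableSet_le measurable_snd measurable_fst)
      exact (measurable_one (α := ENNReal)).indicator hS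
    have : IsSFiniteKernel ((Kernel.const ℝ (volume : Measure ℝ)).withDensity
        fun t s => (Set.Icc 0 t).indicator (1 : ℝ → ENNReal) s) :=
      Kernel.IsSFiniteKernel.withDensity _ fun t s => by by_cases h : s ∈ Set.Icc 0 t <;> simp [h]
    refine ⟨(((Kernel.const ℝ volume).withDensity
      fun t s => (Set.Icc 0 t).indicator (1 : ℝ → ENNReal) s) ⊗ₖ η).snd, inferInstance,
      funext fun t => ?_⟩
    rw [Kernel.snd_compProd_eq_bind, Kernel.withDensity_apply _ hf, Kernel.const_apply,
      withDensity_indicator_one measurableSet_Icc, jumpMarginalN_succ]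
    simp_rw [hη, hκ]

lemma measurable_lastJump_jumpMarginalN {l : E → ℝ} (hl : Measurable l) (k : Kernel E E)
    [IsSFiniteKernel k] (P0 : Measure E) [SFinite P0] (n : ℕ) :
    Measurable (lastJump l k (jumpMarginalN l k P0 n)) := by
  obtain ⟨κ, _, hκ⟩ := exists_kernel_jumpMarginalN hl k P0 n
  obtain ⟨η, _, hη⟩ := exists_kernel_lastJump hl k κ
  rw [← hκ, ← funext hη]
  exact η.measurable

lemma lastJump_le_smul {l : E → ℝ} (hl : Measurable l) (hl0 : ∀ x, 0 ≤ l x) {lbar : ℝ}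
    (hlbar : ∀ x, l x ≤ lbar) (k : Kernel E E) [IsSFiniteKernel k] {κ : ℝ → Measure E}
    {p q : ℝ × ℝ} {C : ENNReal} (h : κ p.2 ≤ C • κ q.2) :
    lastJump l k κ p ≤
      (ENNReal.ofReal (Real.exp (lbar * max ((q.1 - q.2) - (p.1 - p.2)) 0)) * C) •
        lastJump l k κ q := by
  refine Measure.le_iff.2 fun A hA => ?_
  have hm := measurable_withDensity_exp hl k
  have hmA : Measurable fun x => (k x).withDensity
      (fun y => ENNReal.ofReal (Real.exp (-(l y) * (q.1 - q.2)))) A :=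
    (Measure.measurable_coe hA).comp (hm _)
  rw [Measure.smul_apply, lastJump, lastJump, Measure.bind_apply hA (hm _).aemeasurable,
    Measure.bind_apply hA (hm _).aemeasurable, smul_eq_mul, mul_assoc, ← smul_eq_mul (a := C),
    ← lintegral_smul_measure, ← lintegral_const_mul _ hmA, ← withDensity_smul_measure]
  refine lintegral_mono' (withDensity_mono_measure h _) fun x => ?_
  exact withDensity_exp_le_smul (k x) hl hl0 hlbar _ _ A

lemma jumpMarginalN_le_smul {l : E → ℝ} (hl : Measurable l) (hl0 : ∀ x, 0 ≤ l x) {lbar : ℝ}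
    (hlbar : ∀ x, l x ≤ lbar) (k : Kernel E E) [IsSFiniteKernel k] (P0 : Measure E) [SFinite P0]
    {t s : ℝ} (ht : 0 < t) (hs : 0 ≤ s) (n : ℕ) :
    jumpMarginalN l k P0 n s
      ≤ (ENNReal.ofReal (Real.exp (lbar * max (t - s) 0) * (s / t) ^ n)) •
          jumpMarginalN l k P0 n t := by
  induction n generalizing s t with
  | zero => simpa [jumpMarginalN] using withDensity_exp_le_smul P0 hl hl0 hlbar s t
  | succ n ih =>
    rcases hs.eq_or_lt with rfl | hs
    · simp [jumpMarginalN_succ]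
    obtain ⟨c, hc, rfl⟩ : ∃ c, 0 < c ∧ s = c * t := ⟨s / t, by positivity, by field_simp⟩
    have hm := measurable_lastJump_jumpMarginalN hl k P0 n
    have hm' (r : ℝ) : Measurable fun u => lastJump l k (jumpMarginalN l k P0 n) (r, u) :=
      hm.comp measurable_prodMk_left
    refine Measure.le_iff.2 fun A hA => ?_
    have hmA (r : ℝ) : Measurable fun u => lastJump l k (jumpMarginalN l k P0 n) (r, u) A :=
      (Measure.measurable_coe hA).comp (hm' r)
    rw [Measure.smul_apply, jumpMarginalN_succ, jumpMarginalN_succ,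
      Measure.bind_apply hA (hm' _).aemeasurable, Measure.bind_apply hA (hm' _).aemeasurable,
      setLIntegral_Icc_mul_left hc t (hmA _), mul_div_cancel_right₀ c ht.ne', pow_succ',
      mul_left_comm, ENNReal.ofReal_mul hc.le, smul_eq_mul, mul_assoc]
    gcongr
    rw [← lintegral_const_mul _ (hmA _), ← restrict_Ioc_eq_restrict_Icc]
    refine setLIntegral_mono' measurableSet_Ioc fun v hv => ?_
    have hle := ih hv.1 (mul_pos hc hv.1).le
    rw [mul_div_cancel_right₀ c hv.1.ne'] at hle
    refine (lastJump_le_smul hl hl0 hlbar k (p := (c * t, c * v)) (q := (t, v)) hle A).trans_eq ?_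
    rw [Measure.smul_apply, smul_eq_mul, ← ENNReal.ofReal_mul (Real.exp_nonneg _), ← mul_assoc,
      ← Real.exp_add, ← mul_add]
    congr 5
    rcases le_total c 1 with h | h
    · rw [max_eq_left, max_eq_left, max_eq_left] <;> nlinarith [hv.1, hv.2]
    · rw [max_eq_right, max_eq_right, max_eq_right] <;> nlinarith [hv.1, hv.2]

end JumpKernel

/-- for `t > 0`, `s ≥ 0` and every `n`,
`P_{n,s}(dx) ≤ e^{λ̄ (t-s)⁺} (s/t)ⁿ P_{n,t}(dx)` as measures. -/
theorem stmt12 {d : ℕ}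
    (l : EuclideanSpace ℝ (Fin d) → ℝ)
    (k : Kernel (EuclideanSpace ℝ (Fin d)) (EuclideanSpace ℝ (Fin d))) [IsMarkovKernel k]
    (hl : Measurable l) (hl0 : ∀ x, 0 ≤ l x)
    (lbar : ℝ) (hlbar : ∀ x, l x ≤ lbar)
    (hnofake : ∀ x, ENNReal.ofReal (l x) * k x {x} = 0)
    (P0 : Measure (EuclideanSpace ℝ (Fin d))) [IsProbabilityMeasure P0]
    (t s : ℝ) (ht : 0 < t) (hs : 0 ≤ s) (n : ℕ) :
    jumpMarginalN l k P0 n s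
      ≤ (ENNReal.ofReal (Real.exp (lbar * max (t - s) 0) * (s / t) ^ n)) •
          jumpMarginalN l k P0 n t := by
  exact jumpMarginalN_le_smul hl hl0 hlbar k P0 ht hs n
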